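/- arXiv:1208.2792 — 3 statements merged into one kernel-verified Lean document; each statement's English description precedes it below -/
import Mathlib

section
/- Let E be a vector space over a field K and let E₁,…,Eₙ be vector subspaces of E. Then there exists a linearly independent family x₁,…,xₙ in E with x_i ∈ E_i for all i (a free transversal) if and only if for every subset J ⊆ {1,…,n} one has dim_K (∑_{i∈J} E_i) ≥ |J|. -/
/-- Adjoining one vector outside a finite-dimensional subspace raises the dimension by one. -/
theorem Submodule.rank_sup_span_singleton_of_notMem {K E : Type*} [DivisionRing K]
    [AddCommGroup E] [Module K E] {F : Submodule K E} {m : ℕ} (hF : Module.rank K F = m)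
    {x : E} (hx : x ∉ F) :
    Module.rank K ↥(F ⊔ K ∙ x) = ((m + 1 : ℕ) : Cardinal) := by
  have : Module.Finite K F := Module.finite_of_rank_eq_nat hF
  have hlt : F < F ⊔ K ∙ x :=
    lt_of_le_of_ne le_sup_left fun h ↦
      hx (h ▸ Submodule.mem_sup_right (Submodule.mem_span_singleton_self x))
  have h1 := Submodule.finrank_lt_finrank_of_lt hlt
  have h2 := Submodule.finrank_add_le_finrank_add_finrank F (K ∙ x)
  have h3 : Module.finrank K (K ∙ x) ≤ 1 := by
    simpa using finrank_span_le_card (R := K) ({x} : Set E)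
  have h4 : Module.finrank K F = m := Module.finrank_eq_of_rank_eq hF
  rw [← Module.finrank_eq_rank]
  congr 1
  omega

/-- Rado's theorem relative to a finite-dimensional subspace `F`. -/
theorem exists_transversal_rank_sup {K E ι : Type*} [DivisionRing K] [AddCommGroup E]
    [Module K E] [DecidableEq ι] (Es : ι → Submodule K E) (S : Finset ι) (F : Submodule K E)
    (m : ℕ) (hF : Module.rank K F = m)
    (hS : ∀ J ⊆ S, ((J.card + m : ℕ) : Cardinal) ≤ Module.rank K ↥(F ⊔ ⨆ i ∈ J, Es i)) :
    ∃ x : ι → E, (∀ i ∈ S, x i ∈ Es i) ∧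
      ((S.card + m : ℕ) : Cardinal) ≤ Module.rank K ↥(F ⊔ Submodule.span K (x '' S)) := by
  induction S using Finset.strongInduction generalizing F m with
  | H S ih =>
  rcases S.eq_empty_or_nonempty with rfl | ⟨i, hi⟩
  · refine ⟨0, by simp, ?_⟩
    rw [Finset.card_empty, Nat.zero_add, ← hF]
    exact Submodule.rank_mono le_sup_left
  by_cases hcrit : ∃ J ⊂ S, J.Nonempty ∧
      Module.rank K ↥(F ⊔ ⨆ i ∈ J, Es i) = ((J.card + m : ℕ) : Cardinal)
  · obtain ⟨J, hJS, hJ, hrank⟩ := hcrit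
    obtain ⟨x, hx, hxr⟩ := ih J hJS F m hF fun L hL ↦ hS L (hL.trans hJS.subset)
    have hle : F ⊔ Submodule.span K (x '' J) ≤ F ⊔ ⨆ i ∈ J, Es i := by
      refine sup_le_sup_left (Submodule.span_le.2 ?_) F
      rintro _ ⟨j, hj, rfl⟩
      exact Submodule.mem_iSup_of_mem j (Submodule.mem_iSup_of_mem hj (hx j hj))
    have : Module.Finite K ↥(F ⊔ ⨆ i ∈ J, Es i) := Module.finite_of_rank_eq_nat hrank
    have heq : F ⊔ Submodule.span K (x '' J) = F ⊔ ⨆ i ∈ J, Es i := by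
      refine Submodule.eq_of_le_of_finrank_le hle (Cardinal.toNat_le_toNat (hrank ▸ hxr) ?_)
      exact (Submodule.rank_mono hle).trans_lt (Module.rank_lt_aleph0 K _)
    obtain ⟨y, hy, hyr⟩ := ih (S \ J) (Finset.sdiff_ssubset hJS.subset hJ) _ _ hrank fun L hL ↦ by
      have hdisj : Disjoint L J := Finset.disjoint_of_subset_left hL Finset.sdiff_disjoint
      have := hS (L ∪ J) (Finset.union_subset (hL.trans Finset.sdiff_subset) hJS.subset)
      rwa [Finset.card_union_of_disjoint hdisj, Finset.iSup_union, sup_comm (⨆ i ∈ L, Es i),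
        ← sup_assoc, add_assoc] at this
    refine ⟨fun j ↦ if j ∈ J then x j else y j, fun j hj ↦ ?_, ?_⟩
    · by_cases hjJ : j ∈ J
      · simpa [hjJ] using hx j hjJ
      · simpa [hjJ] using hy j (Finset.mem_sdiff.2 ⟨hj, hjJ⟩)
    · have hcard := Finset.card_sdiff_add_card_eq_card hJS.subset
      rw [← add_assoc, hcard, ← heq, sup_assoc, ← Submodule.span_union] at hyr
      refine hyr.trans (Submodule.rank_mono (sup_le_sup_left (Submodule.span_mono ?_) F))
      rintro _ (⟨j, hj, rfl⟩ | ⟨j, hj, rfl⟩)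
      · exact ⟨j, hJS.subset hj, if_pos hj⟩
      · have hj' := Finset.mem_sdiff.1 (Finset.mem_coe.1 hj)
        exact ⟨j, hj'.1, if_neg hj'.2⟩
  · push Not at hcrit
    obtain ⟨v, hv, hvF⟩ : ∃ v ∈ Es i, v ∉ F := by
      by_contra! h
      have := hS {i} (by simpa using hi)
      rw [Finset.iSup_singleton, sup_eq_left.2 h, hF, Finset.card_singleton] at this
      have := Nat.cast_le.1 this
      omega
    have hF' := Submodule.rank_sup_span_singleton_of_notMem hF hvF
    obtain ⟨y, hy, hyr⟩ := ih (S.erase i) (Finset.erase_ssubset hi) _ _ hF' fun L hL ↦ by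
      rcases L.eq_empty_or_nonempty with rfl | hL0
      · rw [Finset.card_empty, Nat.zero_add, ← hF']
        exact Submodule.rank_mono le_sup_left
      have hLS : L ⊂ S := hL.trans_ssubset (Finset.erase_ssubset hi)
      have hlt := lt_of_le_of_ne (hS L hLS.subset) (hcrit L hLS hL0).symm
      rw [← add_assoc, Nat.cast_succ]
      exact (Cardinal.add_one_le_of_lt hlt).trans
        (Submodule.rank_mono (sup_le_sup_right le_sup_left _))
    refine ⟨Function.update y i v, fun j hj ↦ ?_, ?_⟩
    · rcases eq_or_ne j i with rfl | hne
      · simpa using hv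
      · simpa [hne] using hy j (Finset.mem_erase.2 ⟨hne, hj⟩)
    · have hcard := Finset.card_erase_add_one hi
      rw [add_comm m, ← add_assoc, hcard, sup_assoc, ← Submodule.span_union] at hyr
      refine hyr.trans (Submodule.rank_mono (sup_le_sup_left (Submodule.span_mono ?_) F))
      rintro _ (rfl | ⟨j, hj, rfl⟩)
      · exact ⟨i, hi, by simp⟩
      · have hj' := Finset.mem_erase.1 (Finset.mem_coe.1 hj)
        exact ⟨j, hj'.2, by simp [hj'.1]⟩

/-- Rado's linear version of Hall's marriage theorem: a family `E₁,…,Eₙ` of subspaces of a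
vector space `E` over the (possibly skew) field `K` admits a free transversal, i.e. a
linearly independent family `x₁,…,xₙ` with `xᵢ ∈ Eᵢ` for all `i`, iff
`dim (∑_{i ∈ J} Eᵢ) ≥ |J|` for every `J ⊆ {1,…,n}`. -/
theorem free_transversal_iff {K E : Type*} [DivisionRing K] [AddCommGroup E] [Module K E]
    {n : ℕ} (Es : Fin n → Submodule K E) :
    (∃ x : Fin n → E, LinearIndependent K x ∧ ∀ i, x i ∈ Es i) ↔
      ∀ J : Finset (Fin n), (J.card : Cardinal) ≤ Module.rank K ↥(⨆ i ∈ J, Es i) := by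
  constructor
  · rintro ⟨x, hx, hmem⟩ J
    let y : J → ↥(⨆ i ∈ J, Es i) := fun j ↦
      ⟨x j, Submodule.mem_iSup_of_mem j.1 (Submodule.mem_iSup_of_mem j.2 (hmem j))⟩
    have hy : LinearIndependent K y :=
      LinearIndependent.of_comp (Submodule.subtype _) (hx.comp _ Subtype.val_injective)
    simpa using hy.cardinal_lift_le_rank
  · intro h
    obtain ⟨x, hx, hr⟩ := exists_transversal_rank_sup Es Finset.univ ⊥ 0 (by simp)
      fun J _ ↦ by rw [bot_sup_eq]; exact h J
    refine ⟨x, linearIndependent_iff_card_le_finrank_span.2 ?_, fun i ↦ hx i (Finset.mem_univ i)⟩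
    have : Module.Finite K (Submodule.span K (Set.range x)) :=
      Module.Finite.span_of_finite K (Set.finite_range x)
    rw [bot_sup_eq, Finset.coe_univ, Set.image_univ, ← Module.finrank_eq_rank] at hr
    simpa [Set.finrank] using Nat.cast_le.1 hr
end

section
/- Let B be a nonzero finite-dimensional K-subspace of L. Then B is matched to itself if and only if 1 ∉ B. -/
/-- The family `a : Fin n → L` is a basis of the `K`-subspace `A` of `L`. -/
def IsLinBasis (K : Type*) {L : Type*} [Field K] [DivisionRing L] [Algebra K L]
    {n : ℕ} (a : Fin n → L) (A : Submodule K L) : Prop :=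
  LinearIndependent K a ∧ Submodule.span K (Set.range a) = A

/-- The basis `a` of `A` is matched to the basis `b` of `B`: for every `i` and every
`x ∈ B`, if `a i * x ∈ A` then `x` lies in the span of `{b j : j ≠ i}`. -/
def MatchedBases (K : Type*) {L : Type*} [Field K] [DivisionRing L] [Algebra K L]
    {n : ℕ} (a b : Fin n → L) (A B : Submodule K L) : Prop :=
  ∀ i : Fin n, ∀ x ∈ B, a i * x ∈ A → x ∈ Submodule.span K (b '' {j | j ≠ i})

/-- `A` is matched to `B` if every basis of `A` can be matched to some basis of `B`. -/
def SubspaceMatched (K : Type*) {L : Type*} [Field K] [DivisionRing L] [Algebra K L]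
    (A B : Submodule K L) : Prop :=
  ∀ (n : ℕ) (a : Fin n → L), IsLinBasis K a A →
    ∃ b : Fin n → L, IsLinBasis K b B ∧ MatchedBases K a b A B

open Module Submodule in
/-- **Rado's theorem** for subspaces: Hall's condition on dimensions yields a linearly independent
system of representatives. -/
theorem exists_linearIndependent_of_card_le_finrank_sup {K V ι : Type*} [Field K] [AddCommGroup V]
    [Module K V] [FiniteDimensional K V] [Fintype ι] [DecidableEq ι] (W : ι → Submodule K V)
    (hW : ∀ J : Finset ι, J.card ≤ finrank K (J.sup W : Submodule K V)) :
    ∃ w : ι → V, LinearIndependent K w ∧ ∀ i, w i ∈ W i := by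
  induction W using WellFoundedLT.induction with
  | ind W ih =>
  by_cases h : ∃ i, ∃ x ∈ W i, x ≠ 0 ∧ W i ≠ K ∙ x
  · obtain ⟨i, x, hx, hx0, hne⟩ := h
    obtain ⟨C, hC⟩ := Submodule.exists_isCompl (K ∙ x)
    have hxW : (K ∙ x) ≤ W i := by simpa using hx
    have h1 : (K ∙ x) < W i := lt_of_le_of_ne hxW hne.symm
    have h2 : C ⊓ W i < W i := by
      refine lt_of_le_of_ne inf_le_right fun he => hx0 ?_
      have hxC : x ∈ C := (he.ge hx).1
      exact disjoint_def.1 hC.disjoint x (mem_span_singleton_self x) hxC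
    have h12 : (K ∙ x) ⊔ (C ⊓ W i) = W i := by
      rw [← sup_inf_assoc_of_le C hxW, hC.sup_eq_top, top_inf_eq]
    have key : ∀ H < W i, (∃ w : ι → V, LinearIndependent K w ∧ ∀ i, w i ∈ W i) ∨
        ∃ J : Finset ι, i ∉ J ∧ finrank K (H ⊔ J.sup W : Submodule K V) ≤ J.card := by
      intro H hH
      have hlt : Function.update W i H < W := update_lt_self_iff.2 hH
      by_cases hall : ∀ J : Finset ι,
          J.card ≤ finrank K (J.sup (Function.update W i H) : Submodule K V)
      · obtain ⟨w, hw, hwm⟩ := ih _ hlt hall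
        exact Or.inl ⟨w, hw, fun j => hlt.le j (hwm j)⟩
      · push Not at hall
        obtain ⟨J, hJ⟩ := hall
        have hcongr : ∀ T : Finset ι, i ∉ T → T.sup (Function.update W i H) = T.sup W := by
          intro T hT
          refine Finset.sup_congr rfl fun j hj => Function.update_of_ne ?_ _ _
          rintro rfl
          exact hT hj
        by_cases hi : i ∈ J
        · refine Or.inr ⟨J.erase i, Finset.notMem_erase i J, ?_⟩
          have hins : J.sup (Function.update W i H) = H ⊔ (J.erase i).sup W := by
            conv_lhs => rw [← Finset.insert_erase hi]
            rw [Finset.sup_insert, Function.update_self, hcongr _ (Finset.notMem_erase i J)]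
          rw [hins] at hJ
          have := Finset.card_erase_add_one hi
          omega
        · rw [hcongr J hi] at hJ
          exact absurd (hW J) (by omega)
    rcases key _ h1 with h | ⟨J₁, hi₁, hJ₁⟩
    · exact h
    rcases key _ h2 with h | ⟨J₂, hi₂, hJ₂⟩
    · exact h
    exfalso
    have hu := hW (insert i (J₁ ∪ J₂))
    have hn := hW (J₁ ∩ J₂)
    rw [Finset.card_insert_of_notMem (by simp [hi₁, hi₂]), Finset.sup_insert, Finset.sup_union,
      ← h12, sup_sup_sup_comm] at hu
    have hle : (J₁ ∩ J₂).sup W ≤ ((K ∙ x) ⊔ J₁.sup W) ⊓ ((C ⊓ W i) ⊔ J₂.sup W) :=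
      le_inf ((Finset.sup_mono Finset.inter_subset_left).trans le_sup_right)
        ((Finset.sup_mono Finset.inter_subset_right).trans le_sup_right)
    have hn' := finrank_mono hle
    have hd := finrank_sup_add_finrank_inf_eq ((K ∙ x) ⊔ J₁.sup W) ((C ⊓ W i) ⊔ J₂.sup W)
    have hc := Finset.card_union_add_card_inter J₁ J₂
    omega
  · push Not at h
    have hex : ∀ i, ∃ x ∈ W i, x ≠ 0 := by
      intro i
      refine exists_mem_ne_zero_of_ne_bot fun hbot => ?_
      simpa [hbot] using hW {i}
    choose w hwm hw0 using hex
    refine ⟨w, ?_, hwm⟩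
    rw [linearIndependent_iff_card_le_finrank_span, Set.finrank, span_range_eq_iSup]
    have := hW Finset.univ
    rw [Finset.sup_univ_eq_iSup, Finset.card_univ] at this
    have hWw : W = fun i => K ∙ w i := funext fun i => h i _ (hwm i) (hw0 i)
    rwa [hWw] at this

open Module Submodule in
theorem two_mul_finrank_le_finrank_sup_map_add_finrank_inf_comap {K V : Type*} [Field K]
    [AddCommGroup V] [Module K V] (S : Submodule K V) [FiniteDimensional K S] (r : V →ₗ[K] V)
    (hr : Function.Injective r) {v : V} (hv : v ∉ S) (hrv : r v ∈ S) :
    2 * finrank K S ≤ finrank K (S ⊔ (S ⊔ K ∙ v).map r : Submodule K V) +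
      finrank K (S ⊓ S.comap r : Submodule K V) := by
  have hadd : finrank K (S ⊔ K ∙ v : Submodule K V) = finrank K S + 1 := by
    have h := finrank_sup_add_finrank_inf_eq S (K ∙ v)
    have hv0 : v ≠ 0 := fun h0 => hv (h0 ▸ S.zero_mem)
    rw [((disjoint_span_singleton' hv0).2 hv).eq_bot, finrank_bot, finrank_span_singleton hv0] at h
    exact h
  have hmap := (equivMapOfInjective r hr (S ⊔ K ∙ v)).finrank_eq
  have hle : S ⊓ (S ⊔ K ∙ v).map r ≤ ((S ⊓ S.comap r) ⊔ K ∙ v).map r := by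
    rintro _ ⟨hS, x, hx, rfl⟩
    obtain ⟨s, hs, t, ht, rfl⟩ := mem_sup.1 hx
    refine mem_map_of_mem (add_mem_sup ⟨hs, ?_⟩ ht)
    obtain ⟨k, rfl⟩ := mem_span_singleton.1 ht
    have : r s = r (s + k • v) - k • r v := by simp
    change r s ∈ S
    rw [this]
    exact S.sub_mem hS (S.smul_mem k hrv)
  have h1 := finrank_mono hle
  have h2 := finrank_map_le r ((S ⊓ S.comap r) ⊔ K ∙ v)
  have h3 := finrank_add_le_finrank_add_finrank (S ⊓ S.comap r) (K ∙ v)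
  have h4 : finrank K (K ∙ v) = 1 := finrank_span_singleton fun h0 => hv (h0 ▸ S.zero_mem)
  have h5 := finrank_sup_add_finrank_inf_eq S ((S ⊔ K ∙ v).map r)
  omega

open Submodule in
theorem lt_sup_map_of_notMem {K V : Type*} [Field K]
    [AddCommGroup V] [Module K V] (S : Submodule K V) [FiniteDimensional K S] (r : V →ₗ[K] V)
    (hr : Function.Injective r) {v : V} (hv : v ∉ S) :
    S < S ⊔ (S ⊔ K ∙ v).map r := by
  refine lt_of_le_of_ne le_sup_left fun h => hv ?_
  have hle : (S ⊔ K ∙ v).map r ≤ S := sup_eq_left.1 h.symm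
  have heq : S.map r = S := eq_of_le_of_finrank_eq ((map_mono le_sup_left).trans hle)
    (equivMapOfInjective r hr S).finrank_eq.symm
  have hrv : r v ∈ S := hle (mem_map_of_mem (mem_sup_right (mem_span_singleton_self v)))
  rw [← heq] at hrv
  obtain ⟨x, hx, hxv⟩ := hrv
  exact hr hxv ▸ hx

open Module Submodule in
/-- A linear analogue of the Scherk–Kemperman theorem: if a subspace `M` not containing `1` contains
`S`, `U` and all products `s * u`, then the dimensions of `S` and `U` add up to at most that of `M`.
The pair `(S, U)` is transformed by an element of `S ⊓ U` until the intersection is trivial. -/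
theorem finrank_add_finrank_le_of_mul_le {K L : Type*} [Field K] [DivisionRing L] [Algebra K L]
    (M : Submodule K L) [FiniteDimensional K M] (h1 : (1 : L) ∉ M) (S U : Submodule K L)
    (hS : S ≤ M) (hU : U ≤ M) (hSU : ∀ s ∈ S, ∀ u ∈ U, s * u ∈ M) :
    finrank K S + finrank K U ≤ finrank K M := by
  have : FiniteDimensional K S := finiteDimensional_of_le hS
  have : FiniteDimensional K U := finiteDimensional_of_le hU
  by_cases hbot : S ⊓ U = ⊥
  · have h := finrank_sup_add_finrank_inf_eq S U
    rw [hbot, finrank_bot, add_zero] at h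
    rw [← h]
    exact finrank_mono (sup_le hS hU)
  obtain ⟨e, ⟨heS, heU⟩, he⟩ := exists_mem_ne_zero_of_ne_bot hbot
  have hr : Function.Injective (LinearMap.mulRight K e) := mul_left_injective₀ he
  have hl : Function.Injective (LinearMap.mulLeft K e) := mul_right_injective₀ he
  have hS1 : (1 : L) ∉ S := fun h => h1 (hS h)
  have hU1 : (1 : L) ∉ U := fun h => h1 (hU h)
  have hdS := two_mul_finrank_le_finrank_sup_map_add_finrank_inf_comap S _ hr hS1 (by simpa)
  have hdU := two_mul_finrank_le_finrank_sup_map_add_finrank_inf_comap U _ hl hU1 (by simpa)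
  have hltS := lt_sup_map_of_notMem S _ hr hS1
  have hdec : ∀ T : Submodule K L, ∀ x ∈ T ⊔ K ∙ (1 : L), ∃ t ∈ T, ∃ k : K, x = t + k • 1 := by
    intro T x hx
    obtain ⟨t, ht, y, hy, rfl⟩ := mem_sup.1 hx
    obtain ⟨k, rfl⟩ := mem_span_singleton.1 hy
    exact ⟨t, ht, k, rfl⟩
  have hS' : S ⊔ (S ⊔ K ∙ (1 : L)).map (LinearMap.mulRight K e) ≤ M := by
    refine sup_le hS ?_
    rintro _ ⟨x, hx, rfl⟩
    obtain ⟨s, hs, k, rfl⟩ := hdec S x hx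
    simpa [add_mul] using M.add_mem (hSU s hs e heU) (M.smul_mem k (hS heS))
  have hU' : U ⊔ (U ⊔ K ∙ (1 : L)).map (LinearMap.mulLeft K e) ≤ M := by
    refine sup_le hU ?_
    rintro _ ⟨x, hx, rfl⟩
    obtain ⟨u, hu, k, rfl⟩ := hdec U x hx
    simpa [mul_add] using M.add_mem (hSU e heS u hu) (M.smul_mem k (hS heS))
  have : FiniteDimensional K
    (S ⊔ (S ⊔ K ∙ (1 : L)).map (LinearMap.mulRight K e) : Submodule K L) :=
      finiteDimensional_of_le hS'
  have hltS' := finrank_lt_finrank_of_lt hltS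
  have hb1 := finrank_mono hS
  have hb2 := finrank_mono hU
  have hb3 := finrank_mono hS'
  have hb4 := finrank_mono hU'
  by_cases hc : finrank K S + finrank K U ≤
      finrank K (S ⊔ (S ⊔ K ∙ (1 : L)).map (LinearMap.mulRight K e) : Submodule K L) +
      finrank K (U ⊓ U.comap (LinearMap.mulLeft K e) : Submodule K L)
  · have hb5 : finrank K (U ⊓ U.comap (LinearMap.mulLeft K e) : Submodule K L) ≤ finrank K U :=
      finrank_mono inf_le_left
    refine hc.trans (finrank_add_finrank_le_of_mul_le M h1 _ _ hS' (inf_le_left.trans hU) ?_)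
    rintro x hx u ⟨hu, hu'⟩
    obtain ⟨s, hs, _, ⟨y, hy, rfl⟩, rfl⟩ := mem_sup.1 hx
    obtain ⟨t, ht, k, rfl⟩ := hdec S y hy
    simpa [add_mul, mul_assoc] using M.add_mem (hSU s hs u hu)
      (M.add_mem (hSU t ht _ hu') (M.smul_mem k (hU hu')))
  · have hlt : finrank K S + finrank K U <
        finrank K (S ⊓ S.comap (LinearMap.mulRight K e) : Submodule K L) +
        finrank K (U ⊔ (U ⊔ K ∙ (1 : L)).map (LinearMap.mulLeft K e) : Submodule K L) := by omega
    have hb5 : finrank K (S ⊓ S.comap (LinearMap.mulRight K e) : Submodule K L) ≤ finrank K S :=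
      finrank_mono inf_le_left
    refine hlt.le.trans (finrank_add_finrank_le_of_mul_le M h1 _ _ (inf_le_left.trans hS) hU' ?_)
    rintro s ⟨hs, hs'⟩ x hx
    obtain ⟨u, hu, _, ⟨y, hy, rfl⟩, rfl⟩ := mem_sup.1 hx
    obtain ⟨t, ht, k, rfl⟩ := hdec U y hy
    have hs'' : s * e ∈ S := hs'
    simpa [mul_add, mul_assoc] using M.add_mem (hSU s hs u hu)
      (M.add_mem (hSU _ hs'' t ht) (M.smul_mem k (hS hs'')))
termination_by (2 * finrank K M - (finrank K S + finrank K U), finrank K M - finrank K S)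
decreasing_by
  all_goals
    rw [Prod.lex_def]
    dsimp only
    omega

open Module Submodule in
/-- Subspaces `X i` of dimension at most complementary to `J` on every intersection over `J` avoid
the coordinate directions of a suitable basis. -/
theorem exists_basis_forall_mem_span_image_ne {K V : Type*} [Field K] [AddCommGroup V] [Module K V]
    [FiniteDimensional K V] {n : ℕ} (hn : finrank K V = n) (X : Fin n → Submodule K V)
    (hX : ∀ J : Finset (Fin n), J.card + finrank K (J.inf X : Submodule K V) ≤ n) :
    ∃ b : Basis (Fin n) K V, ∀ i, ∀ x ∈ X i, x ∈ span K (b '' {j | j ≠ i}) := by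
  have hann : ∀ J : Finset (Fin n),
      J.sup (fun i => (X i).dualAnnihilator) = (J.inf X).dualAnnihilator := by
    intro J
    induction J using Finset.induction_on with
    | empty => simp
    | insert i J _ ih => rw [Finset.sup_insert, Finset.inf_insert, ih,
        Subspace.dualAnnihilator_inf_eq]
  obtain ⟨w, hw, hwm⟩ := exists_linearIndependent_of_card_le_finrank_sup
    (fun i => (X i).dualAnnihilator) fun J => by
      rw [hann]
      have h := Subspace.finrank_add_finrank_dualAnnihilator_eq (J.inf X)
      have := hX J
      omega
  have hcard : Fintype.card (Fin n) = finrank K (Dual K V) := by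
    rw [Subspace.dual_finrank_eq, hn, Fintype.card_fin]
  let wb : Basis (Fin n) K (Dual K V) := basisOfLinearIndependentOfCardEqFinrank' w hw hcard
  let b : Basis (Fin n) K V := wb.dualBasis.map (evalEquiv K V).symm
  have hb : ∀ i j, w i (b j) = if i = j then 1 else 0 := by
    intro i j
    have h : w i (b j) = wb.dualBasis j (wb i) := by
      simp [b, wb]
    rw [h, Basis.dualBasis_apply_self]
  refine ⟨b, fun i x hx => ?_⟩
  have hwx : w i x = 0 := (mem_dualAnnihilator _).1 (hwm i) x hx
  have hrepr : w i x = b.repr x i := by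
    conv_lhs => rw [← b.sum_repr x]
    simp only [map_sum, map_smul, hb]
    simp
  rw [b.mem_span_image]
  intro j hj
  rintro rfl
  simp_all

/-- A nonzero finite-dimensional `K`-subspace `B` of `L` is matched to itself iff `1 ∉ B`. -/
theorem automatching_subspace_iff {K L : Type*} [Field K] [DivisionRing L] [Algebra K L]
    (B : Submodule K L) [FiniteDimensional K B] (hB : B ≠ ⊥) :
    SubspaceMatched K B B ↔ (1 : L) ∉ B := by
  constructor
  · intro h h1
    obtain ⟨b, ⟨hli, hspan⟩, hm⟩ := h _ (fun i => (Module.finBasis K B i : L))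
      ⟨(Module.finBasis K B).linearIndependent.map' B.subtype B.ker_subtype, by
        have := congrArg (Submodule.map B.subtype) (Module.finBasis K B).span_eq
        rwa [Submodule.map_span, ← Set.range_comp, Submodule.map_top, Submodule.range_subtype]
          at this⟩
    have h1span : (1 : L) ∈ Submodule.span K (Set.range b) := by rwa [hspan]
    obtain ⟨c, hc⟩ := (Submodule.mem_span_range_iff_exists_fun K).1 h1span
    have hc0 : ∀ i, c i = 0 := by
      intro i
      by_contra hci
      have hmem := hm i 1 h1 (by simp)
      have hsum : c i • b i = 1 - ∑ j ∈ Finset.univ.erase i, c j • b j := by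
        rw [← hc, ← Finset.add_sum_erase _ _ (Finset.mem_univ i), add_sub_cancel_right]
      have hi : c i • b i ∈ Submodule.span K (b '' {j | j ≠ i}) := by
        rw [hsum]
        refine Submodule.sub_mem _ hmem (Submodule.sum_mem _ fun j hj => ?_)
        exact Submodule.smul_mem _ _ (Submodule.subset_span ⟨j, Finset.ne_of_mem_erase hj, rfl⟩)
      exact hli.notMem_span_image (s := {j | j ≠ i}) (x := i) (by simp)
        ((Submodule.smul_mem_iff _ hci).1 hi)
    simp [hc0] at hc
  · rintro h1 n a ⟨hli, hspan⟩
    have ha : ∀ i, a i ∈ B := fun i => hspan ▸ Submodule.subset_span ⟨i, rfl⟩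
    have hn : Module.finrank K B = n := by
      rw [← hspan, finrank_span_eq_card hli, Fintype.card_fin]
    obtain ⟨b, hb⟩ := exists_basis_forall_mem_span_image_ne hn
      (fun i => (B.comap (LinearMap.mulLeft K (a i))).comap B.subtype) fun J => by
        set X := J.inf fun i => (B.comap (LinearMap.mulLeft K (a i))).comap B.subtype
        have hJ : Module.finrank K (Submodule.span K (a '' J)) = J.card := by
          rw [Set.image_eq_range]
          exact (finrank_span_eq_card (hli.comp _ Subtype.val_injective)).trans (by simp)
        rw [← hJ, ← Submodule.finrank_map_subtype_eq B X]
        refine (finrank_add_finrank_le_of_mul_le B h1 _ (X.map B.subtype) ?_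
          (Submodule.map_subtype_le _ _) ?_).trans hn.le
        · rw [Submodule.span_le]
          rintro _ ⟨i, _, rfl⟩
          exact ha i
        · rintro s hs _ ⟨u, hu, rfl⟩
          have hle : Submodule.span K (a '' J) ≤ B.comap (LinearMap.mulRight K (u : L)) := by
            rw [Submodule.span_le]
            rintro _ ⟨i, hi, rfl⟩
            exact (Finset.inf_le (f := fun i =>
              (B.comap (LinearMap.mulLeft K (a i))).comap B.subtype) hi) hu
          exact hle hs
    refine ⟨fun i => (b i : L), ⟨b.linearIndependent.map' B.subtype B.ker_subtype, ?_⟩, ?_⟩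
    · have := congrArg (Submodule.map B.subtype) b.span_eq
      rwa [Submodule.map_span, ← Set.range_comp, Submodule.map_top, Submodule.range_subtype] at this
    · intro i x hx hax
      have := Submodule.mem_map_of_mem (f := B.subtype) (hb i ⟨x, hx⟩ hax)
      rwa [Submodule.map_span, ← Set.image_comp] at this
end

section
/- Let B be a finite-dimensional K-subspace of L with 1 ∉ B, let {a₁,…,aₙ} be a basis of B, and for J ⊆ {1,…,n} let V_J = {x ∈ B : a_i·x ∈ B for all i ∈ J} and let B_J = span_K{a_i : i ∈ J}. Then dim_K B_J + dim_K V_J ≤ dim_K B, i.e., dim_K V_J ≤ n − |J|, for every J ⊆ {1,…,n}. -/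
open Module

section Transform

variable {K M : Type*} [Field K] [AddCommGroup M] [Module K M]

lemma finrank_sup_map_add_finrank_inf_comap {f : M →ₗ[K] M} (hf : Function.Injective f)
    (A : Submodule K M) [FiniteDimensional K A] :
    finrank K ↥(A ⊔ A.map f) + finrank K ↥(A ⊓ A.comap f) = 2 * finrank K A := by
  have h_map : (A ⊓ A.comap f).map f = A ⊓ A.map f := by
    ext y
    simp only [Submodule.mem_map, Submodule.mem_inf, Submodule.mem_comap]
    grind
  rw [(Submodule.equivMapOfInjective f hf (A ⊓ A.comap f)).finrank_eq, h_map,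
    Submodule.finrank_sup_add_finrank_inf_eq,
    ← (Submodule.equivMapOfInjective f hf A).finrank_eq, two_mul]

lemma finrank_inf_comap_lt {f : M →ₗ[K] M} (hf : Function.Injective f)
    {A : Submodule K M} [FiniteDimensional K A] {x : M} (hx : x ∉ A) (hfx : f x ∈ A) :
    finrank K ↥(A ⊓ A.comap f) < finrank K A := by
  refine Submodule.finrank_lt_finrank_of_lt (inf_le_left.lt_of_ne fun h ↦ hx ?_)
  have h_map : A.map f = A :=
    Submodule.eq_of_le_of_finrank_eq (Submodule.map_le_iff_le_comap.2 (inf_eq_left.1 h))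
      ((Submodule.equivMapOfInjective f hf A).finrank_eq.symm)
  rw [← h_map] at hfx
  obtain ⟨y, hy, hyx⟩ := hfx
  exact hf hyx ▸ hy

end Transform

/-- A linear analogue of Kemperman's theorem on products in which `1` is uniquely represented. -/
theorem finrank_add_finrank_le_of_mul_mem {K L : Type*} [Field K] [DivisionRing L] [Algebra K L]
    {U : Submodule K L} [FiniteDimensional K U] (h1 : (1 : L) ∉ U) {A V : Submodule K L}
    (hA : A ≤ U) (hV : V ≤ U) (hAV : ∀ x ∈ A, ∀ y ∈ V, x * y ∈ U) :
    finrank K A + finrank K V ≤ finrank K U := by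
  induction hk : 2 * finrank K U - (finrank K A + finrank K V) using Nat.strong_induction_on
    generalizing A V with
  | _ k ihk =>
  induction hd : finrank K V using Nat.strong_induction_on generalizing A V with
  | _ d ihd =>
  subst hk hd
  have : FiniteDimensional K A := Submodule.finiteDimensional_of_le hA
  have : FiniteDimensional K V := Submodule.finiteDimensional_of_le hV
  by_cases h_inf : A ⊓ V = ⊥
  · have h_sup := Submodule.finrank_sup_add_finrank_inf_eq A V
    rw [h_inf, finrank_bot] at h_sup
    have := Submodule.finrank_mono (sup_le hA hV)
    omega
  obtain ⟨e, ⟨heA, heV⟩, he⟩ := Submodule.exists_mem_ne_zero_of_ne_bot h_inf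
  have hl : Function.Injective (LinearMap.mulLeft K e) := mul_right_injective₀ he
  have hr : Function.Injective (LinearMap.mulRight K e) := mul_left_injective₀ he
  have hA_sum := finrank_sup_map_add_finrank_inf_comap hr A
  have hV_sum := finrank_sup_map_add_finrank_inf_comap hl V
  have hV_lt := finrank_inf_comap_lt hl (fun h ↦ h1 (hV h)) (by simpa using heV)
  have hA_le : A ⊔ A.map (LinearMap.mulRight K e) ≤ U :=
    sup_le hA (Submodule.map_le_iff_le_comap.2 fun x hx ↦ hAV x hx e heV)
  have hV_le : V ⊔ V.map (LinearMap.mulLeft K e) ≤ U :=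
    sup_le hV (Submodule.map_le_iff_le_comap.2 fun y hy ↦ hAV e heA y hy)
  have hAV_right : ∀ x ∈ A ⊔ A.map (LinearMap.mulRight K e),
      ∀ y ∈ V ⊓ V.comap (LinearMap.mulLeft K e), x * y ∈ U := by
    rintro x hx y ⟨hy, hey⟩
    obtain ⟨a, ha, _, ⟨b, hb, rfl⟩, rfl⟩ := Submodule.mem_sup.1 hx
    rw [LinearMap.mulRight_apply, add_mul, mul_assoc]
    exact U.add_mem (hAV a ha y hy) (hAV b hb _ hey)
  have hAV_left : ∀ x ∈ A ⊓ A.comap (LinearMap.mulRight K e),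
      ∀ y ∈ V ⊔ V.map (LinearMap.mulLeft K e), x * y ∈ U := by
    rintro x ⟨hx, hxe⟩ y hy
    obtain ⟨a, ha, _, ⟨b, hb, rfl⟩, rfl⟩ := Submodule.mem_sup.1 hy
    rw [LinearMap.mulLeft_apply, mul_add, ← mul_assoc]
    exact U.add_mem (hAV x hx a ha) (hAV _ hxe b hb)
  have hV_mono := Submodule.finrank_mono hV_le
  have hA_fin := Submodule.finrank_mono hA
  have hV_inf := inf_le_left.trans hV (a := V ⊓ V.comap (LinearMap.mulLeft K e))
  have hA_inf := inf_le_left.trans hA (a := A ⊓ A.comap (LinearMap.mulRight K e))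
  rcases lt_trichotomy (finrank K A + finrank K V)
    (finrank K ↥(A ⊔ A.map (LinearMap.mulRight K e)) +
      finrank K ↥(V ⊓ V.comap (LinearMap.mulLeft K e))) with h | h | h
  · have := ihk _ (by omega) hA_le hV_inf hAV_right rfl
    omega
  · have := ihd _ hV_lt hA_le hV_inf hAV_right (by omega) rfl
    omega
  · have := ihk _ (by omega) hA_inf hV_le hAV_left rfl
    omega

/-- For a finite-dimensional `K`-subspace `B` of `L` with `1 ∉ B`, a basis `a₁,…,aₙ` of `B`
and `J ⊆ {1,…,n}`, setting `V_J = {x ∈ B : aᵢ x ∈ B for all i ∈ J}` and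
`B_J = span {aᵢ : i ∈ J}`, one has `dim B_J + dim V_J ≤ dim B`, i.e.
`dim V_J ≤ n - |J|`. -/
theorem dim_inter_le {K L : Type*} [Field K] [DivisionRing L] [Algebra K L]
    {n : ℕ} (B : Submodule K L) [FiniteDimensional K B] (h1 : (1 : L) ∉ B)
    (a : Fin n → L) (ha : IsLinBasis K a B) (J : Finset (Fin n)) :
    Module.finrank K ↥(Submodule.span K (a '' ↑J)) +
        Module.finrank K ↥(B ⊓ ⨅ i ∈ J, B.comap (LinearMap.mulLeft K (a i))) ≤
      Module.finrank K B ∧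
    Module.finrank K ↥(B ⊓ ⨅ i ∈ J, B.comap (LinearMap.mulLeft K (a i))) ≤ n - J.card := by
  have h_span : finrank K ↥(Submodule.span K (a '' ↑J)) = J.card := by
    have h := finrank_span_eq_card (ha.1.comp (Subtype.val : J → Fin n) Subtype.val_injective)
    rwa [Set.range_comp, Subtype.range_coe_subtype, Finset.setOfPred_mem, Fintype.card_coe] at h
  have hB : finrank K B = n := by
    rw [← ha.2, finrank_span_eq_card ha.1, Fintype.card_fin]
  have h_le : finrank K ↥(Submodule.span K (a '' ↑J)) +
      finrank K ↥(B ⊓ ⨅ i ∈ J, B.comap (LinearMap.mulLeft K (a i))) ≤ finrank K B := by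
    refine finrank_add_finrank_le_of_mul_mem h1 ?_ inf_le_left ?_
    · rw [← ha.2]
      exact Submodule.span_mono (Set.image_subset_range _ _)
    · rintro x hx y ⟨-, hy⟩
      have h_sub : Submodule.span K (a '' ↑J) ≤ B.comap (LinearMap.mulRight K y) := by
        rw [Submodule.span_le]
        rintro _ ⟨i, hi, rfl⟩
        simp only [SetLike.mem_coe, Submodule.mem_iInf] at hy
        exact hy i hi
      exact h_sub hx
  exact ⟨h_le, by omega⟩
end
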